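/- The central extension bracket defines a Lie algebra: on the product LaurentSeries ℂ × ℂ, define ⁅(f, a), (g, b)⁆ := (0, Res(g * D f)). Then this bracket is ℂ-bilinear, satisfies ⁅x, x⁆ = 0 for all x, and satisfies the Jacobi identity ⁅x, ⁅y, z⁆⁆ + ⁅y, ⁅z, x⁆⁆ + ⁅z, ⁅x, y⁆⁆ = 0 for all x, y, z; thus it makes LaurentSeries ℂ × ℂ into a Lie algebra over ℂ (the Heisenberg algebra ℋ). -/

import Mathlib

open HahnSeries

/-- The formal derivative of Laurent series, defined coefficientwise by
`(D f).coeff n = (n + 1) • f.coeff (n + 1)`. -/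
noncomputable def D : LaurentSeries ℂ →ₗ[ℂ] LaurentSeries ℂ where
  toFun f :=
    { coeff := fun n => (n + 1) • f.coeff (n + 1)
      isPWO_support' := by
        have hmono : MonotoneOn (fun n : ℤ => n - 1) f.support := by
          intro a _ b _ h
          simpa using sub_le_sub_right h 1
        refine Set.IsPWO.mono (f.isPWO_support.image_of_monotoneOn hmono) ?_
        intro n hn
        have hf : f.coeff (n + 1) ≠ 0 := by
          intro h
          simp [h] at hn
        exact ⟨n + 1, hf, by ring⟩ }
  map_add' f g := by
    ext n
    simp [smul_add]
  map_smul' c f := by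
    ext n
    simp
    ring

/-- The residue of a formal Laurent series: the coefficient of `z⁻¹`. -/
noncomputable def Res (f : LaurentSeries ℂ) : ℂ := f.coeff (-1)

/-- The bracket of the central extension: `⁅(f, a), (g, b)⁆ = (0, Res (g * D f))`. -/
noncomputable def heisenbergBracket (x y : LaurentSeries ℂ × ℂ) :
    LaurentSeries ℂ × ℂ :=
  (0, Res (y.1 * D x.1))

theorem D_coeff_aux (f : LaurentSeries ℂ) (n : ℤ) :
    (D f).coeff n = ((n : ℂ) + 1) * f.coeff (n + 1) := by
  have h : (D f).coeff n = (n + 1) • f.coeff (n + 1) := rfl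
  rw [h, zsmul_eq_mul]
  push_cast
  rfl

theorem Res_mul_D_self_aux (f : LaurentSeries ℂ) : Res (f * D f) = 0 := by
  unfold Res
  rw [HahnSeries.coeff_mul]
  refine Finset.sum_involution (fun p _ => (p.2 + 1, p.1 - 1)) ?_ ?_ ?_ ?_
  · rintro ⟨i, j⟩ h
    have hs : i + j = -1 := (Finset.mem_antidiagonal.1 h).2.2
    have hi : i = -1 - j := by omega
    subst hi
    simp only [D_coeff_aux, sub_add_cancel]
    push_cast
    ring
  · rintro ⟨i, j⟩ h hne heq
    have hs : i + j = -1 := (Finset.mem_antidiagonal.1 h).2.2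
    have h1 : j + 1 = i := congrArg Prod.fst heq
    have hj : j = -1 := by omega
    apply hne
    simp [D_coeff_aux, hj]
  · rintro ⟨i, j⟩ h
    obtain ⟨h1, h2, hs⟩ := Finset.mem_antidiagonal.1 h
    simp only [HahnSeries.mem_support, D_coeff_aux] at h1 h2 hs
    have h3 := left_ne_zero_of_mul h2
    have h4 := right_ne_zero_of_mul h2
    refine Finset.mem_antidiagonal.2 ⟨h4, ?_, ?_⟩
    · simp only [HahnSeries.mem_support, D_coeff_aux, sub_add_cancel]
      refine mul_ne_zero ?_ h1
      intro h0
      apply h3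
      have hi : i = -1 - j := by omega
      subst hi
      push_cast at h0
      linear_combination -h0
    · simp only
      omega
  · rintro ⟨i, j⟩ h
    simp

theorem smul_eq_C_mul_aux (a : ℂ) (f : LaurentSeries ℂ) :
    a • f = HahnSeries.C a * f :=
  (HahnSeries.C_mul_eq_smul).symm

theorem coeff_C_mul_aux (a : ℂ) (f : LaurentSeries ℂ) (n : ℤ) :
    (HahnSeries.C a * f).coeff n = a * f.coeff n := by
  rw [← smul_eq_C_mul_aux]
  rfl

theorem heisenberg_is_lie_algebra :
    (∀ (a : ℂ) (x x' y : LaurentSeries ℂ × ℂ),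
        heisenbergBracket (a • x + x') y =
          a • heisenbergBracket x y + heisenbergBracket x' y) ∧
    (∀ (a : ℂ) (x y y' : LaurentSeries ℂ × ℂ),
        heisenbergBracket x (a • y + y') =
          a • heisenbergBracket x y + heisenbergBracket x y') ∧
    (∀ x : LaurentSeries ℂ × ℂ, heisenbergBracket x x = 0) ∧
    (∀ x y z : LaurentSeries ℂ × ℂ,
        heisenbergBracket x (heisenbergBracket y z) +
          heisenbergBracket y (heisenbergBracket z x) +
          heisenbergBracket z (heisenbergBracket x y) = 0) := by
  refine ⟨?_, ?_, ?_, ?_⟩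
  · intro a x x' y
    simp [heisenbergBracket, Res, mul_add]
    rw [smul_eq_C_mul_aux, mul_left_comm, coeff_C_mul_aux]
  · intro a x y y'
    simp [heisenbergBracket, Res, add_mul]
    rw [smul_eq_C_mul_aux, mul_assoc, coeff_C_mul_aux]
  · intro x
    simp [heisenbergBracket, Res_mul_D_self_aux]
  · intro x y z
    simp [heisenbergBracket, Res]
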